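/- For every w ∈ L^{2,1}(ℝ) and every x₀ ≥ 0, one has sup_{x ∈ (x₀,∞)} ‖⟨x⟩ ∫_{+∞}^{x} e^{-iz(x-y)} w(y) dy‖_{L²_z(ℝ)} ≤ √(2π) ‖w‖_{L^{2,1}(x₀,∞)}, where ⟨x⟩ = (1+x²)^{1/2}. -/

import Mathlib

open MeasureTheory
open scoped FourierTransform SchwartzMap ContDiff

/-- On `L¹ ∩ L²`, the `L²` Fourier transform is given by the Fourier integral. -/
theorem fourier_toLp_ae_eq {f : ℝ → ℂ} (hf : Integrable f) (hf₂ : MemLp f 2) :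
    (𝓕 (hf₂.toLp f) : Lp ℂ 2 (volume : Measure ℝ)) =ᵐ[volume] 𝓕 f := by
  apply ae_eq_of_integral_contDiff_smul_eq
  · exact (Lp.memLp _).locallyIntegrable (by norm_num)
  · exact (VectorFourier.fourierIntegral_continuous Real.continuous_fourierChar
      (by fun_prop) hf).locallyIntegrable
  · intro g g_smooth g_cpt
    have hg₁ : HasCompactSupport (Complex.ofRealCLM ∘ g) := g_cpt.comp_left rfl
    have hg₂ : ContDiff ℝ ∞ (Complex.ofRealCLM ∘ g) := by fun_prop
    set φ : 𝓢(ℝ, ℂ) := hg₁.toSchwartzMap hg₂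
    have hφg : ∀ x, φ x = (g x : ℂ) := fun x => rfl
    calc ∫ x, g x • (𝓕 (hf₂.toLp f) : Lp ℂ 2 (volume : Measure ℝ)) x
        = Lp.toTemperedDistribution (𝓕 (hf₂.toLp f)) φ := by
          rw [Lp.toTemperedDistribution_apply]; simp [hφg]
      _ = ∫ x, (𝓕 φ) x • (hf₂.toLp f) x := by
          rw [← Lp.fourier_toTemperedDistribution_eq, TemperedDistribution.fourier_apply,
            Lp.toTemperedDistribution_apply]
      _ = ∫ x, (𝓕 φ) x • f x := by
          apply integral_congr_ae
          filter_upwards [hf₂.coeFn_toLp] with x hx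
          rw [hx]
      _ = ∫ x, φ x • 𝓕 f x := by
          rw [SchwartzMap.fourier_coe]
          simpa using! VectorFourier.integral_fourierIntegral_smul_eq_flip (L := innerₗ ℝ)
            Real.continuous_fourierChar continuous_inner φ.integrable hf
      _ = _ := by simp [hφg]

/-- Plancherel's theorem for the Fourier integral on `L¹ ∩ L²`. -/
theorem integral_norm_sq_fourier_eq {f : ℝ → ℂ} (hf : Integrable f) (hf₂ : MemLp f 2) :
    ∫ z, ‖𝓕 f z‖ ^ 2 = ∫ y, ‖f y‖ ^ 2 := by
  have h := Lp.inner_fourier_eq (hf₂.toLp f) (hf₂.toLp f)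
  rw [L2.inner_def, L2.inner_def] at h
  simp only [inner_self_eq_norm_sq_to_K] at h
  have h₁ : ∫ z, ((‖𝓕 f z‖ : ℂ)) ^ 2 = ∫ y, ((‖f y‖ : ℂ)) ^ 2 := by
    refine (integral_congr_ae ?_).trans (h.trans (integral_congr_ae ?_))
    · filter_upwards [fourier_toLp_ae_eq hf hf₂] with z hz
      rw [hz]; rfl
    · filter_upwards [hf₂.coeFn_toLp] with y hy
      rw [hy]; rfl
  simp only [← Complex.ofReal_pow] at h₁
  rw [integral_complex_ofReal, integral_complex_ofReal] at h₁
  exact_mod_cast h₁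

/-- An `L²` bound for the Fourier-type integral of `w` over a half-line.
The left-hand integral is zero when `w` is not measurable on `(x, ∞)`, so only integrability of
`(1 + y²) ‖w y‖²` is needed. -/
theorem integral_norm_sq_exp_Ioi_le {w : ℝ → ℂ}
    (hw : Integrable (fun y : ℝ => (1 + y ^ 2) * ‖w y‖ ^ 2)) (x : ℝ) :
    ∫ z : ℝ, ‖∫ y in Set.Ioi x,
        Complex.exp (-Complex.I * (z : ℂ) * ((x : ℂ) - (y : ℂ))) * w y‖ ^ 2
      ≤ 2 * Real.pi * ∫ y in Set.Ioi x, ‖w y‖ ^ 2 := by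
  by_cases hm : AEStronglyMeasurable w (volume.restrict (Set.Ioi x))
  · set f : ℝ → ℂ := (Set.Ioi x).indicator w with hf_def
    have hfm : AEStronglyMeasurable f := (aestronglyMeasurable_indicator_iff measurableSet_Ioi).2 hm
    have hfw : ∀ y, ‖f y‖ ≤ ‖w y‖ := fun y => norm_indicator_le_norm_self _ _
    have hf : Integrable f := by
      refine (hw.add integrable_inv_one_add_sq).mono' hfm (.of_forall fun y => ?_)
      refine (hfw y).trans ?_
      have h1 : 0 < 1 + y ^ 2 := by positivity
      have h2 : (1 + y ^ 2) * (1 + y ^ 2)⁻¹ = 1 := mul_inv_cancel₀ h1.ne'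
      have h3 : 0 < (1 + y ^ 2)⁻¹ := by positivity
      simp only [Pi.add_apply]
      nlinarith [mul_nonneg h3.le (sq_nonneg ((1 + y ^ 2) * ‖w y‖ - 1)), norm_nonneg (w y)]
    have hf₂ : MemLp f 2 := by
      rw [memLp_two_iff_integrable_sq_norm hfm]
      refine hw.mono' (hfm.norm.pow 2) (.of_forall fun y => ?_)
      have h4 : ‖f y‖ ^ 2 ≤ ‖w y‖ ^ 2 := by gcongr; exact hfw y
      rw [Real.norm_of_nonneg (by positivity)]
      nlinarith [mul_nonneg (sq_nonneg y) (sq_nonneg ‖w y‖)]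
    have key : ∀ z : ℝ, ‖∫ y in Set.Ioi x,
        Complex.exp (-Complex.I * (z : ℂ) * ((x : ℂ) - (y : ℂ))) * w y‖ ^ 2
          = ‖𝓕 f (z * (-(2 * Real.pi)⁻¹))‖ ^ 2 := by
      intro z
      have : ∫ y in Set.Ioi x, Complex.exp (-Complex.I * (z : ℂ) * ((x : ℂ) - (y : ℂ))) * w y
          = Complex.exp ((-(z * x) : ℝ) * Complex.I) * 𝓕 f (z * (-(2 * Real.pi)⁻¹)) := by
        rw [Real.fourier_eq', ← integral_const_mul, ← integral_indicator measurableSet_Ioi]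
        congr 1 with y
        by_cases hy : y ∈ Set.Ioi x
        · simp only [hf_def, Set.indicator_of_mem hy, smul_eq_mul]
          rw [← mul_assoc, ← Complex.exp_add]
          congr 2
          have hpi : (Real.pi : ℂ) ≠ 0 := by exact_mod_cast Real.pi_ne_zero
          simp
          field_simp
          ring
        · simp [hf_def, Set.indicator_of_notMem hy]
      rw [this, norm_mul, Complex.norm_exp_ofReal_mul_I, one_mul]
    simp_rw [key]
    rw [Measure.integral_comp_mul_right (fun z => ‖𝓕 f z‖ ^ 2), integral_norm_sq_fourier_eq hf hf₂,
      ← integral_indicator measurableSet_Ioi]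
    apply le_of_eq
    congr 1
    · simp [abs_of_pos Real.pi_pos]
    · congr 1 with y
      by_cases hy : y ∈ Set.Ioi x <;> simp [hf_def, hy]
  · have key : ∀ z : ℝ, ∫ y in Set.Ioi x,
        Complex.exp (-Complex.I * (z : ℂ) * ((x : ℂ) - (y : ℂ))) * w y = 0 := by
      intro z
      refine integral_non_aestronglyMeasurable fun h => hm ?_
      have hc : Continuous fun y : ℝ =>
          Complex.exp (Complex.I * (z : ℂ) * ((x : ℂ) - (y : ℂ))) := by fun_prop
      refine (hc.aestronglyMeasurable.mul h).congr (.of_forall fun y => ?_)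
      simp only [Pi.mul_apply]
      rw [← mul_assoc, ← Complex.exp_add]
      simp
    simp only [key, norm_zero, ne_eq, OfNat.ofNat_ne_zero, not_false_eq_true, zero_pow, integral_zero]
    positivity

/-- For every `w ∈ L^{2,1}(ℝ)` and every `x₀ ≥ 0`,
`sup_{x ∈ (x₀,∞)} ‖⟨x⟩ ∫_{+∞}^{x} e^{-iz(x-y)} w(y) dy‖_{L²_z(ℝ)} ≤ √(2π) ‖w‖_{L^{2,1}(x₀,∞)}`,
where `⟨x⟩ = (1+x²)^{1/2}`. -/
theorem stmt2 (w : ℝ → ℂ)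
    (hw : Integrable (fun y : ℝ => (1 + y ^ 2) * ‖w y‖ ^ 2)) :
    ∀ x₀ : ℝ, 0 ≤ x₀ → ∀ x ∈ Set.Ioi x₀,
      Real.sqrt (∫ z : ℝ,
          ‖(Real.sqrt (1 + x ^ 2) : ℂ) *
              (-(∫ y in Set.Ioi x,
                  Complex.exp (-Complex.I * (z : ℂ) * ((x : ℂ) - (y : ℂ))) * w y))‖ ^ 2)
        ≤ Real.sqrt (2 * Real.pi) *
            Real.sqrt (∫ y in Set.Ioi x₀, (1 + y ^ 2) * ‖w y‖ ^ 2) := by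
  intro x₀ hx₀ x hx
  have hx' : x₀ < x := hx
  rw [← Real.sqrt_mul (by positivity)]
  apply Real.sqrt_le_sqrt
  have hsq : ‖(Real.sqrt (1 + x ^ 2) : ℂ)‖ ^ 2 = 1 + x ^ 2 := by
    rw [Complex.norm_real, Real.norm_of_nonneg (Real.sqrt_nonneg _), Real.sq_sqrt (by positivity)]
  simp_rw [norm_mul, norm_neg, mul_pow, hsq]
  rw [integral_const_mul]
  have hmono : (1 + x ^ 2) * ∫ y in Set.Ioi x, ‖w y‖ ^ 2
      ≤ ∫ y in Set.Ioi x, (1 + y ^ 2) * ‖w y‖ ^ 2 := by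
    rw [← integral_const_mul]
    refine integral_mono_of_nonneg (.of_forall fun y => by positivity) hw.integrableOn ?_
    refine (ae_restrict_iff' measurableSet_Ioi).2 (.of_forall fun y hy => ?_)
    have hy' : x < y := hy
    have : 0 ≤ x := hx₀.trans hx'.le
    dsimp only
    gcongr
  have hset : ∫ y in Set.Ioi x, (1 + y ^ 2) * ‖w y‖ ^ 2
      ≤ ∫ y in Set.Ioi x₀, (1 + y ^ 2) * ‖w y‖ ^ 2 :=
    setIntegral_mono_set hw.integrableOn (.of_forall fun y => by positivity)
      (Set.Ioi_subset_Ioi hx'.le).eventuallyLE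
  calc _ ≤ (1 + x ^ 2) * (2 * Real.pi * ∫ y in Set.Ioi x, ‖w y‖ ^ 2) := by
        gcongr
        exact integral_norm_sq_exp_Ioi_le hw x
    _ = 2 * Real.pi * ((1 + x ^ 2) * ∫ y in Set.Ioi x, ‖w y‖ ^ 2) := by ring
    _ ≤ _ := by
        gcongr
        exact hmono.trans hset
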